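/- arXiv:2004.02830 — 6 statements merged into one kernel-verified Lean document; each statement's English description precedes it below -/
import Mathlib

section
/- Let h : Fin n → Fin m → ℝ be entrywise nonnegative. Then the Continuous Histogram Loss satisfies L(h) = 0 if and only if for all indices r ≤ r' in Fin n and z < z' in Fin m, h_{r,z} · h_{r',z'} = 0 (i.e., no two nonzero histogram entries have weakly increasing distance bin together with strictly increasing similarity bin). -/
open Finset

def phi {n m : ℕ} (h : Fin n → Fin m → ℝ) (r : Fin n) (z : Fin m) : ℝ :=
  ∑ r' ∈ Finset.univ.filter (fun r' => r ≤ r'),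
    ∑ z' ∈ Finset.univ.filter (fun z' => z < z'), h r' z'

def CHL {n m : ℕ} (h : Fin n → Fin m → ℝ) : ℝ :=
  ∑ r, ∑ z, h r z * phi h r z

theorem chl_zero_iff_no_reversal {n m : ℕ} (h : Fin n → Fin m → ℝ)
    (hpos : ∀ r z, 0 ≤ h r z) :
    CHL h = 0 ↔
      ∀ (r r' : Fin n) (z z' : Fin m), r ≤ r' → z < z' → h r z * h r' z' = 0 := by
  have e : CHL h = ∑ r, ∑ z, ∑ r' ∈ Finset.univ.filter (fun r' => r ≤ r'),
      ∑ z' ∈ Finset.univ.filter (fun z' => z < z'), h r z * h r' z' := by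
    simp only [CHL, phi, Finset.mul_sum]
  have p : ∀ r z r' z', 0 ≤ h r z * h r' z' := fun r z r' z' =>
    mul_nonneg (hpos r z) (hpos r' z')
  rw [e]
  constructor
  · intro H r r' z z' hr hz
    have h1 := (Finset.sum_eq_zero_iff_of_nonneg (fun r _ => Finset.sum_nonneg fun z _ =>
      Finset.sum_nonneg fun r' _ => Finset.sum_nonneg fun z' _ => p r z r' z')).1 H r
      (Finset.mem_univ _)
    have h2 := (Finset.sum_eq_zero_iff_of_nonneg (fun z _ =>
      Finset.sum_nonneg fun r' _ => Finset.sum_nonneg fun z' _ => p r z r' z')).1 h1 z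
      (Finset.mem_univ _)
    have h3 := (Finset.sum_eq_zero_iff_of_nonneg (fun r' _ =>
      Finset.sum_nonneg fun z' _ => p r z r' z')).1 h2 r' (by simpa using hr)
    exact (Finset.sum_eq_zero_iff_of_nonneg (fun z' _ => p r z r' z')).1 h3 z'
      (by simpa using hz)
  · intro H
    refine Finset.sum_eq_zero fun r _ => Finset.sum_eq_zero fun z _ =>
      Finset.sum_eq_zero fun r' hr => Finset.sum_eq_zero fun z' hz => ?_
    exact H r r' z z' (by simpa using hr) (by simpa using hz)
end

section
/- Let h : Fin n → Fin m → ℝ be entrywise nonnegative and suppose there exists a strictly decreasing function f : Fin m → Fin n such that for all r ∈ Fin n and z ∈ Fin m, h_{r,z} ≠ 0 implies r = f(z) (each similarity column has all its mass concentrated in the single distance bin f(z), and f is strictly monotonically decreasing). Then L(h) = 0. -/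
open Finset

theorem chl_zero_of_strictAnti_support {n m : ℕ} (h : Fin n → Fin m → ℝ)
    (hpos : ∀ r z, 0 ≤ h r z) (f : Fin m → Fin n) (hf : StrictAnti f)
    (hsupp : ∀ (r : Fin n) (z : Fin m), h r z ≠ 0 → r = f z) :
    CHL h = 0 := by
  unfold CHL
  refine Finset.sum_eq_zero fun r _ => Finset.sum_eq_zero fun z _ => ?_
  by_cases h0 : h r z = 0
  · rw [h0, zero_mul]
  · have hr := hsupp r z h0
    have : phi h r z = 0 := by
      unfold phi
      refine Finset.sum_eq_zero fun r' hr' => Finset.sum_eq_zero fun z' hz' => ?_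
      by_contra h1
      have e := hsupp r' z' h1
      have hle : r ≤ r' := (Finset.mem_filter.mp hr').2
      have hlt : z < z' := (Finset.mem_filter.mp hz').2
      rw [hr, e] at hle
      exact absurd (hf hlt) (not_lt.mpr hle)
    rw [this, mul_zero]
end

section
/- The Continuous Histogram Loss L : (Fin n → Fin m → ℝ) → ℝ is differentiable, and for every h and every pair of indices (r₀, z₀), its partial derivative at h in coordinate (r₀, z₀) (the Fréchet derivative of L at h applied to the standard basis matrix with 1 in entry (r₀, z₀) and 0 elsewhere) equals φ(h)_{r₀,z₀} + ψ(h)_{r₀,z₀}. -/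
open Finset

def psi {n m : ℕ} (h : Fin n → Fin m → ℝ) (r : Fin n) (z : Fin m) : ℝ :=
  ∑ r' ∈ Finset.univ.filter (fun r' => r' ≤ r),
    ∑ z' ∈ Finset.univ.filter (fun z' => z' < z), h r' z'

theorem chl_aux_hasFDerivAt {n m : ℕ} (h : Fin n → Fin m → ℝ) :
    ∃ L : (Fin n → Fin m → ℝ) →L[ℝ] ℝ, HasFDerivAt CHL L h ∧
      ∀ v, L v = ∑ r, ∑ z, (h r z * phi v r z + phi h r z * v r z) := by
  let e : Fin n → Fin m → ((Fin n → Fin m → ℝ) →L[ℝ] ℝ) := fun r z =>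
    (ContinuousLinearMap.proj (R := ℝ) (φ := fun _ : Fin m => ℝ) z).comp
      (ContinuousLinearMap.proj (R := ℝ) (φ := fun _ : Fin n => Fin m → ℝ) r)
  let P : Fin n → Fin m → ((Fin n → Fin m → ℝ) →L[ℝ] ℝ) := fun r z =>
    ∑ r' ∈ Finset.univ.filter (fun r' => r ≤ r'),
      ∑ z' ∈ Finset.univ.filter (fun z' => z < z'), e r' z'
  have he : ∀ r z v, e r z v = v r z := fun r z v => rfl
  have hP : ∀ r z v, P r z v = phi v r z := by
    intro r z v
    simp [P, phi, ContinuousLinearMap.sum_apply, he]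
  refine ⟨∑ r, ∑ z, (h r z • P r z + phi h r z • e r z), ?_, ?_⟩
  · have : (CHL : (Fin n → Fin m → ℝ) → ℝ) = fun x => ∑ r, ∑ z, e r z x * P r z x := by
      funext x
      simp only [hP, he, CHL]
    rw [this]
    refine HasFDerivAt.fun_sum fun r _ => HasFDerivAt.fun_sum fun z _ => ?_
    have := (e r z).hasFDerivAt (x := h) |>.mul ((P r z).hasFDerivAt (x := h))
    rw [hP, he] at this
    exact this
  · intro v
    simp [ContinuousLinearMap.sum_apply, he, hP]

theorem chl_differentiable_and_grad {n m : ℕ} :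
    Differentiable ℝ (CHL : (Fin n → Fin m → ℝ) → ℝ) ∧
    ∀ (h : Fin n → Fin m → ℝ) (r₀ : Fin n) (z₀ : Fin m),
      fderiv ℝ CHL h (Pi.single r₀ (Pi.single z₀ (1 : ℝ))) =
        phi h r₀ z₀ + psi h r₀ z₀ := by
  refine ⟨fun h => ?_, fun h r₀ z₀ => ?_⟩
  · obtain ⟨L, hL, -⟩ := chl_aux_hasFDerivAt h
    exact hL.differentiableAt
  · obtain ⟨L, hL, hv⟩ := chl_aux_hasFDerivAt h
    rw [hL.fderiv, hv]
    have hs : ∀ r z, (Pi.single r₀ (Pi.single z₀ (1 : ℝ)) : Fin n → Fin m → ℝ) r z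
        = if r = r₀ then (if z = z₀ then 1 else 0) else 0 := by
      intro r z
      by_cases hr : r = r₀
      · subst hr
        simp [Pi.single_apply]
      · simp [hr]
    have hp : ∀ r z, phi (Pi.single r₀ (Pi.single z₀ (1 : ℝ)) : Fin n → Fin m → ℝ) r z
        = if r ≤ r₀ then (if z < z₀ then 1 else 0) else 0 := by
      intro r z
      simp only [phi, hs, Finset.sum_filter]
      rw [Finset.sum_eq_single r₀]
      · by_cases hr : r ≤ r₀
        · rw [if_pos hr, if_pos hr, Finset.sum_eq_single z₀]
          · simp
          · intro b _ hb
            simp [hb]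
          · simp
        · simp [hr]
      · intro b _ hb
        simp [hb]
      · simp
    simp only [hs, hp, Finset.sum_add_distrib]
    rw [add_comm]
    congr 1
    · rw [Finset.sum_eq_single r₀]
      · simp
      · intro b _ hb
        simp [hb]
      · simp
    · simp only [psi, Finset.sum_filter]
      refine Finset.sum_congr rfl fun r _ => ?_
      by_cases hr : r ≤ r₀ <;> simp [hr]
end

section
/- The alternative loss L₁ : (Fin n → Fin m → ℝ) → ℝ is differentiable, and for every h and every pair of indices (r₀, z₀), its partial derivative at h in coordinate (r₀, z₀) equals ψ(h)_{r₀,z₀} + φ(h)_{r₀,z₀}; consequently the partial derivative of L₂ = L + L₁ at h in coordinate (r₀, z₀) equals 2·(ψ(h)_{r₀,z₀} + φ(h)_{r₀,z₀}), so L, L₁ and L₂ have equal gradients up to a multiplicative constant. -/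
open Finset

def CHL₁ {n m : ℕ} (h : Fin n → Fin m → ℝ) : ℝ :=
  ∑ r, ∑ z, h r z * psi h r z

def CHL₂ {n m : ℕ} (h : Fin n → Fin m → ℝ) : ℝ :=
  CHL h + CHL₁ h

theorem aux_psi_single {n m : ℕ} (r₀ : Fin n) (z₀ : Fin m) (r : Fin n) (z : Fin m) :
    psi (Pi.single r₀ (Pi.single z₀ (1 : ℝ))) r z = if r₀ ≤ r ∧ z₀ < z then 1 else 0 := by
  unfold psi
  simp only [Finset.sum_filter]
  rw [Finset.sum_eq_single r₀, Finset.sum_eq_single z₀]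
  · by_cases h1 : r₀ ≤ r <;> by_cases h2 : z₀ < z <;> simp [h1, h2]
  · intro b _ hb; simp [hb]
  · simp
  · intro b _ hb; simp [hb]
  · simp

theorem aux_CHL_eq {n m : ℕ} (h : Fin n → Fin m → ℝ) : CHL h = CHL₁ h := by
  have e1 : CHL h = ∑ r, ∑ z, ∑ r', ∑ z', if r ≤ r' ∧ z < z' then h r z * h r' z' else 0 := by
    unfold CHL phi
    refine Finset.sum_congr rfl fun r _ => Finset.sum_congr rfl fun z _ => ?_
    rw [Finset.sum_filter, Finset.mul_sum]
    refine Finset.sum_congr rfl fun r' _ => ?_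
    by_cases h1 : r ≤ r' <;> simp [h1, Finset.sum_filter, Finset.mul_sum]
  have e2 : CHL₁ h = ∑ r, ∑ z, ∑ r', ∑ z', if r' ≤ r ∧ z' < z then h r z * h r' z' else 0 := by
    unfold CHL₁ psi
    refine Finset.sum_congr rfl fun r _ => Finset.sum_congr rfl fun z _ => ?_
    rw [Finset.sum_filter, Finset.mul_sum]
    refine Finset.sum_congr rfl fun r' _ => ?_
    by_cases h1 : r' ≤ r <;> simp [h1, Finset.sum_filter, Finset.mul_sum]
  rw [e1, e2]
  have key : ∀ f : Fin n → Fin m → Fin n → Fin m → ℝ,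
      ∑ r, ∑ z, ∑ r', ∑ z', f r z r' z' = ∑ r, ∑ z, ∑ r', ∑ z', f r' z' r z := by
    intro f
    have := Finset.sum_comm (s := (Finset.univ : Finset (Fin n × Fin m)))
      (t := (Finset.univ : Finset (Fin n × Fin m))) (f := fun a b => f a.1 a.2 b.1 b.2)
    simpa only [Fintype.sum_prod_type] using this
  rw [key]
  simp only [mul_comm]

theorem aux_hasFDerivAt {n m : ℕ} (h : Fin n → Fin m → ℝ) :
    ∃ L : (Fin n → Fin m → ℝ) →L[ℝ] ℝ, HasFDerivAt CHL₁ L h ∧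
      ∀ k, L k = ∑ r, ∑ z, (h r z * psi k r z + psi h r z * k r z) := by
  let p : Fin n → Fin m → ((Fin n → Fin m → ℝ) →L[ℝ] ℝ) := fun r z =>
    (ContinuousLinearMap.proj (R := ℝ) (φ := fun _ : Fin m => ℝ) z).comp
      (ContinuousLinearMap.proj (R := ℝ) (φ := fun _ : Fin n => Fin m → ℝ) r)
  let q : Fin n → Fin m → ((Fin n → Fin m → ℝ) →L[ℝ] ℝ) := fun r z =>
    ∑ r' ∈ Finset.univ.filter (fun r' => r' ≤ r),
      ∑ z' ∈ Finset.univ.filter (fun z' => z' < z), p r' z'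
  have hp : ∀ r z k, p r z k = k r z := fun r z k => rfl
  have hq : ∀ r z k, q r z k = psi k r z := by
    intro r z k
    simp [q, psi, hp]
  refine ⟨∑ r, ∑ z, (h r z • q r z + psi h r z • p r z), ?_, ?_⟩
  · have : (CHL₁ : (Fin n → Fin m → ℝ) → ℝ) = fun k => ∑ r, ∑ z, p r z k * q r z k := by
      funext k; simp only [CHL₁, hp, hq]
    rw [this]
    refine HasFDerivAt.fun_sum fun r _ => HasFDerivAt.fun_sum fun z _ => ?_
    have := (p r z).hasFDerivAt (x := h) |>.mul ((q r z).hasFDerivAt (x := h))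
    rw [hp, hq] at this
    exact this
  · intro k
    simp [hp, hq]

theorem aux_grad {n m : ℕ} (h : Fin n → Fin m → ℝ) (r₀ : Fin n) (z₀ : Fin m) :
    fderiv ℝ CHL₁ h (Pi.single r₀ (Pi.single z₀ (1 : ℝ))) = psi h r₀ z₀ + phi h r₀ z₀ := by
  obtain ⟨L, hL, hk⟩ := aux_hasFDerivAt h
  rw [hL.fderiv, hk]
  simp only [Finset.sum_add_distrib, aux_psi_single]
  rw [add_comm]
  congr 1
  · rw [Finset.sum_eq_single r₀, Finset.sum_eq_single z₀]
    · simp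
    · intro b _ hb; simp [hb]
    · simp
    · intro b _ hb; simp [hb]
    · simp
  · unfold phi
    rw [Finset.sum_filter]
    refine Finset.sum_congr rfl fun r _ => ?_
    by_cases h1 : r₀ ≤ r <;> simp [h1, Finset.sum_filter]

theorem chl₁_differentiable_and_grad {n m : ℕ} :
    Differentiable ℝ (CHL₁ : (Fin n → Fin m → ℝ) → ℝ) ∧
    (∀ (h : Fin n → Fin m → ℝ) (r₀ : Fin n) (z₀ : Fin m),
      fderiv ℝ CHL₁ h (Pi.single r₀ (Pi.single z₀ (1 : ℝ))) =
        psi h r₀ z₀ + phi h r₀ z₀) ∧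
    (∀ (h : Fin n → Fin m → ℝ) (r₀ : Fin n) (z₀ : Fin m),
      fderiv ℝ CHL₂ h (Pi.single r₀ (Pi.single z₀ (1 : ℝ))) =
        2 * (psi h r₀ z₀ + phi h r₀ z₀)) := by
  have hd : Differentiable ℝ (CHL₁ : (Fin n → Fin m → ℝ) → ℝ) := fun h => by
    obtain ⟨L, hL, _⟩ := aux_hasFDerivAt h
    exact hL.differentiableAt
  refine ⟨hd, aux_grad, fun h r₀ z₀ => ?_⟩
  have h2 : (CHL₂ : (Fin n → Fin m → ℝ) → ℝ) = fun k => CHL₁ k + CHL₁ k := by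
    funext k; rw [CHL₂, aux_CHL_eq]
  rw [h2, ((hd h).hasFDerivAt.fun_add (hd h).hasFDerivAt).fderiv, _root_.add_apply, aux_grad]
  ring
end

section
/- Let M be a positive natural number, let similarity bin labels z : Fin M → Fin m be fixed, fix Δ > 0 with nodes t_k = k·Δ, and define the histogram h(d)_{r,ζ} = (1/M) · ∑_{i : z_i = ζ} δ_r(d_i) and the Continuous Histogram Loss L(h) = ∑_{r,ζ} h_{r,ζ} · φ(h)_{r,ζ}. Fix i ∈ Fin M and suppose d_i ∈ (t_{r_i}, t_{r_i+1}) for some index r_i with r_i + 1 < n. Then the partial derivative of the composite map d ↦ L(h(d)) with respect to d_i equals (1/(Δ·M)) · ( ∑_{ζ < z_i} h(d)_{r_i+1,ζ} − ∑_{ζ > z_i} h(d)_{r_i,ζ} ). -/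
open Finset

/-- Triangular kernel with nodes `t_k = k * Δ`. -/
noncomputable def tri (Δ : ℝ) (r : ℤ) (d : ℝ) : ℝ :=
  if d ∈ Set.Icc (((r : ℝ) - 1) * Δ) ((r : ℝ) * Δ) then (d - ((r : ℝ) - 1) * Δ) / Δ
  else if d ∈ Set.Icc ((r : ℝ) * Δ) (((r : ℝ) + 1) * Δ) then (((r : ℝ) + 1) * Δ - d) / Δ
  else 0

/-- Histogram built from distances `d` and fixed similarity bin labels `z`. -/
noncomputable def hist {M m : ℕ} (n : ℕ) (Δ : ℝ) (z : Fin M → Fin m)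
    (d : Fin M → ℝ) (r : Fin n) (ζ : Fin m) : ℝ :=
  (1 / (M : ℝ)) * ∑ i ∈ Finset.univ.filter (fun i => z i = ζ), tri Δ ((r : ℕ) : ℤ) (d i)

noncomputable def cc (Δ : ℝ) (a r : ℕ) : ℝ :=
  (if r = a + 1 then 1 / Δ else 0) - (if r = a then 1 / Δ else 0)

lemma tri_deriv (Δ : ℝ) (hΔ : 0 < Δ) (x : ℝ) (a r : ℕ)
    (hx : x ∈ Set.Ioo ((a : ℝ) * Δ) (((a : ℝ) + 1) * Δ)) :
    HasDerivAt (fun t => tri Δ ((r : ℕ) : ℤ) t) (cc Δ a r) x := by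
  have hev : ∀ᶠ t in nhds x, t ∈ Set.Ioo ((a : ℝ) * Δ) (((a : ℝ) + 1) * Δ) :=
    isOpen_Ioo.mem_nhds hx
  rcases lt_trichotomy r a with h | h | h
  · have hc : cc Δ a r = 0 := by
      unfold cc; rw [if_neg (by omega), if_neg (by omega)]; ring
    rw [hc]
    refine (hasDerivAt_const x (0 : ℝ)).congr_of_eventuallyEq ?_
    filter_upwards [hev] with t ht
    have h1 : (r : ℝ) + 1 ≤ a := by exact_mod_cast h
    have h2 : ((r : ℝ) + 1) * Δ ≤ a * Δ := by gcongr
    have h3 := ht.1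
    unfold tri
    push_cast
    rw [if_neg, if_neg]
    · rintro ⟨_, h5⟩; linarith
    · rintro ⟨_, h5⟩; nlinarith
  · subst h
    have hc : cc Δ r r = -1 / Δ := by
      unfold cc; rw [if_neg (by omega), if_pos rfl]; ring
    rw [hc]
    refine (((hasDerivAt_id x).const_sub (((r : ℝ) + 1) * Δ)).div_const Δ).congr_of_eventuallyEq ?_
    filter_upwards [hev] with t ht
    unfold tri
    push_cast
    rw [if_neg, if_pos]
    · rfl
    · exact ⟨ht.1.le, ht.2.le⟩
    · rintro ⟨_, h5⟩; linarith [ht.1]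
  · rcases Nat.lt_or_ge (a + 1) r with h' | h'
    · have hc : cc Δ a r = 0 := by
        unfold cc; rw [if_neg (by omega), if_neg (by omega)]; ring
      rw [hc]
      refine (hasDerivAt_const x (0 : ℝ)).congr_of_eventuallyEq ?_
      filter_upwards [hev] with t ht
      have h1 : (a : ℝ) + 1 ≤ r - 1 := by
        have : ((a + 1 + 1 : ℕ) : ℝ) ≤ r := by exact_mod_cast h'
        push_cast at this; linarith
      have h2 : ((a : ℝ) + 1) * Δ ≤ (r - 1) * Δ := by gcongr
      have h3 := ht.2
      unfold tri
      push_cast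
      rw [if_neg, if_neg]
      · rintro ⟨h5, _⟩; nlinarith
      · rintro ⟨h5, _⟩; linarith
    · obtain rfl : r = a + 1 := by omega
      have hc : cc Δ a (a + 1) = 1 / Δ := by
        unfold cc; rw [if_pos rfl, if_neg (by omega)]; ring
      rw [hc]
      refine (((hasDerivAt_id x).sub_const ((a : ℝ) * Δ)).div_const Δ).congr_of_eventuallyEq ?_
      filter_upwards [hev] with t ht
      unfold tri
      push_cast
      rw [if_pos]
      · simp
      · exact ⟨by simpa using ht.1.le, ht.2.le⟩

noncomputable def gg {m : ℕ} (n : ℕ) (Δ : ℝ) (M : ℕ) (a : ℕ) (w : Fin m) (r : Fin n) (ζ : Fin m) : ℝ :=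
  if ζ = w then (1 / (M : ℝ)) * cc Δ a r else 0

lemma hist_deriv {M m n : ℕ} (z : Fin M → Fin m)
    (Δ : ℝ) (hΔ : 0 < Δ) (d : Fin M → ℝ) (i : Fin M) (a : ℕ)
    (hd : d i ∈ Set.Ioo ((a : ℝ) * Δ) (((a : ℝ) + 1) * Δ)) (r : Fin n) (ζ : Fin m) :
    HasDerivAt (fun t => hist n Δ z (Function.update d i t) r ζ) (gg n Δ M a (z i) r ζ) (d i) := by
  have key : ∀ j : Fin M, HasDerivAt (fun t => tri Δ ((r : ℕ) : ℤ) (Function.update d i t j))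
      (if j = i then cc Δ a r else 0) (d i) := by
    intro j
    by_cases h : j = i
    · subst h
      simpa using tri_deriv Δ hΔ (d j) a r hd
    · simpa [h] using hasDerivAt_const (d i) (tri Δ ((r : ℕ) : ℤ) (d j))
  have := (HasDerivAt.fun_sum (u := Finset.univ.filter (fun j => z j = ζ))
    (fun j _ => key j)).const_mul (1 / (M : ℝ))
  refine this.congr_deriv ?_
  rw [Finset.sum_ite_eq']
  unfold gg
  by_cases h : ζ = z i
  · simp [h]
  · simp [h, Ne.symm h]

lemma phi_deriv {m n : ℕ} {h : ℝ → Fin n → Fin m → ℝ} {g : Fin n → Fin m → ℝ} {x : ℝ}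
    (H : ∀ r ζ, HasDerivAt (fun t => h t r ζ) (g r ζ) x) (r : Fin n) (ζ : Fin m) :
    HasDerivAt (fun t => phi (h t) r ζ) (phi g r ζ) x := by
  unfold phi
  exact HasDerivAt.fun_sum fun r' _ => HasDerivAt.fun_sum fun z' _ => H r' z'

lemma CHL_deriv {m n : ℕ} {h : ℝ → Fin n → Fin m → ℝ} {g : Fin n → Fin m → ℝ} {x : ℝ}
    (H : ∀ r ζ, HasDerivAt (fun t => h t r ζ) (g r ζ) x) :
    HasDerivAt (fun t => CHL (h t))
      (∑ r, ∑ ζ, (g r ζ * phi (h x) r ζ + h x r ζ * phi g r ζ)) x := by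
  unfold CHL
  exact HasDerivAt.fun_sum fun r _ => HasDerivAt.fun_sum fun ζ _ =>
    (H r ζ).mul (phi_deriv H r ζ)

lemma cc_sum {n : ℕ} (Δ : ℝ) (a : ℕ) (ha : a + 1 < n) (f : Fin n → ℝ) :
    ∑ r : Fin n, cc Δ a r * f r = (1 / Δ) * (f ⟨a + 1, ha⟩ - f ⟨a, Nat.lt_of_succ_lt ha⟩) := by
  have h1 : ∀ r : Fin n, cc Δ a r * f r = (if r = ⟨a + 1, ha⟩ then 1 / Δ * f r else 0)
      - (if r = ⟨a, Nat.lt_of_succ_lt ha⟩ then 1 / Δ * f r else 0) := by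
    intro r
    simp only [cc, Fin.ext_iff, sub_mul, ite_mul, zero_mul]
  simp_rw [h1, Finset.sum_sub_distrib, Finset.sum_ite_eq']
  simp only [Finset.mem_univ, if_true]
  ring

lemma phi_gg {m n : ℕ} (Δ : ℝ) (M a : ℕ) (ha : a + 1 < n) (w : Fin m) (r : Fin n) (ζ : Fin m) :
    phi (gg n Δ M a w) r ζ =
      if ζ < w then (if r = ⟨a + 1, ha⟩ then 1 / (Δ * M) else 0) else 0 := by
  unfold phi gg
  simp_rw [Finset.sum_ite_eq', Finset.mem_filter, Finset.mem_univ, true_and]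
  by_cases h : ζ < w
  · simp only [h, if_true]
    rw [← Finset.mul_sum, Finset.sum_filter]
    have := cc_sum Δ a ha (fun r' => if r ≤ r' then 1 else 0)
    simp only [mul_ite, mul_one, mul_zero] at this
    rw [this]
    simp only [Fin.le_def, Fin.ext_iff]
    split_ifs
    all_goals first | omega | (simp [mul_comm]; done) 
  · simp [h]

lemma phi_diff {m n : ℕ} (h : Fin n → Fin m → ℝ) (a : ℕ) (ha : a + 1 < n) (w : Fin m) :
    phi h ⟨a + 1, ha⟩ w - phi h ⟨a, Nat.lt_of_succ_lt ha⟩ w =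
      - ∑ ζ ∈ Finset.univ.filter (fun ζ => w < ζ), h ⟨a, Nat.lt_of_succ_lt ha⟩ ζ := by
  unfold phi
  have : Finset.univ.filter (fun r' : Fin n => ⟨a, Nat.lt_of_succ_lt ha⟩ ≤ r') =
      insert ⟨a, Nat.lt_of_succ_lt ha⟩ (Finset.univ.filter (fun r' : Fin n => ⟨a + 1, ha⟩ ≤ r')) := by
    ext r
    simp only [Finset.mem_filter, Finset.mem_univ, true_and, Finset.mem_insert, Fin.le_def,
      Fin.ext_iff]
    omega
  rw [this, Finset.sum_insert (by simp [Fin.le_def])]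
  ring

theorem chl_hist_partial_deriv {M m n : ℕ} (hM : 0 < M) (z : Fin M → Fin m)
    (Δ : ℝ) (hΔ : 0 < Δ) (d : Fin M → ℝ) (i : Fin M)
    (rᵢ : ℕ) (hrᵢ : rᵢ + 1 < n)
    (hd : d i ∈ Set.Ioo ((rᵢ : ℝ) * Δ) (((rᵢ : ℝ) + 1) * Δ)) :
    HasDerivAt (fun t => CHL (hist n Δ z (Function.update d i t)))
      ((1 / (Δ * M)) *
        (∑ ζ ∈ Finset.univ.filter (fun ζ => ζ < z i),
            hist n Δ z d ⟨rᵢ + 1, hrᵢ⟩ ζ -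
          ∑ ζ ∈ Finset.univ.filter (fun ζ => z i < ζ),
            hist n Δ z d ⟨rᵢ, Nat.lt_of_succ_lt hrᵢ⟩ ζ)) (d i) := by
  refine (CHL_deriv (fun r ζ => hist_deriv z Δ hΔ d i rᵢ hd r ζ)).congr_deriv ?_
  rw [Function.update_eq_self]
  generalize hist n Δ z d = h
  simp_rw [Finset.sum_add_distrib]
  have e1 : ∑ r, ∑ ζ, gg n Δ M rᵢ (z i) r ζ * phi h r ζ =
      (1 / (Δ * M)) * (- ∑ ζ ∈ Finset.univ.filter (fun ζ => z i < ζ),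
        h ⟨rᵢ, Nat.lt_of_succ_lt hrᵢ⟩ ζ) := by
    simp only [gg, ite_mul, zero_mul, Finset.sum_ite_eq', Finset.mem_univ, if_true, mul_assoc]
    rw [← Finset.mul_sum, cc_sum Δ rᵢ hrᵢ (fun r => phi h r (z i)), phi_diff,
      ← mul_assoc, one_div_mul_one_div, mul_comm (M : ℝ)]
  have e2 : ∑ r, ∑ ζ, h r ζ * phi (gg n Δ M rᵢ (z i)) r ζ =
      (1 / (Δ * M)) * ∑ ζ ∈ Finset.univ.filter (fun ζ => ζ < z i), h ⟨rᵢ + 1, hrᵢ⟩ ζ := by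
    simp_rw [phi_gg Δ M rᵢ hrᵢ]
    rw [Finset.sum_comm, Finset.sum_filter, Finset.mul_sum]
    refine Finset.sum_congr rfl fun ζ _ => ?_
    by_cases hz : ζ < z i
    · simp only [hz, if_true, mul_ite, mul_zero, Finset.sum_ite_eq', Finset.mem_univ]
      ring
    · simp [hz]
  rw [e1, e2]
  ring
end

section
/- Let h : Fin n → Fin m → ℝ and suppose there exist indices z₀ < z₁ in Fin m such that h_{r,z} = 0 whenever z ≠ z₀ and z ≠ z₁ (binary similarity). Then the Continuous Histogram Loss reduces to the Histogram Loss form: L(h) = ∑_{r} h_{r,z₀} · ∑_{q ≥ r} h_{q,z₁}. -/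
open Finset

theorem chl_binary_reduces_to_histogram_loss {n m : ℕ} (h : Fin n → Fin m → ℝ)
    (z₀ z₁ : Fin m) (hz : z₀ < z₁)
    (hbin : ∀ (r : Fin n) (z : Fin m), z ≠ z₀ → z ≠ z₁ → h r z = 0) :
    CHL h = ∑ r, h r z₀ * ∑ q ∈ Finset.univ.filter (fun q => r ≤ q), h q z₁ := by
  unfold CHL
  refine Finset.sum_congr rfl fun r _ => ?_
  have h1 : phi h r z₁ = 0 := by
    unfold phi
    refine Finset.sum_eq_zero fun r' _ => Finset.sum_eq_zero fun z' hz' => ?_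
    have hlt : z₁ < z' := (Finset.mem_filter.mp hz').2
    exact hbin r' z' (hz.trans hlt).ne' hlt.ne'
  have h0 : phi h r z₀ = ∑ q ∈ Finset.univ.filter (fun q => r ≤ q), h q z₁ := by
    unfold phi
    refine Finset.sum_congr rfl fun r' _ => ?_
    refine Finset.sum_eq_single_of_mem z₁ (by simp [hz]) fun z' hz' hne => ?_
    have hlt : z₀ < z' := (Finset.mem_filter.mp hz').2
    exact hbin r' z' hlt.ne' hne
  rw [← h0]
  refine Finset.sum_eq_single_of_mem z₀ (Finset.mem_univ _) fun z _ hne => ?_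
  by_cases hz1 : z = z₁
  · rw [hz1, h1, mul_zero]
  · rw [hbin r z hne hz1, zero_mul]
end
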